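/- arXiv:2510.17091 — 2 statements merged into one kernel-verified Lean document; each statement's English description precedes it below -/
import Mathlib

section
/- Fix an integer n ≥ 3. For all real numbers 0 < a < b < ∞, the first Dirichlet eigenvalue of the annulus A_{a,b} ⊆ ℝⁿ satisfies ((n−3)(n−1))/(4b²) + π²/(b−a)² ≤ λ(A_{a,b}) ≤ π²/(b−a)² + ((n−3)(n−1))/(4a²). -/
open Real MeasureTheory

noncomputable def dirichletEigenvalue (n : ℕ) (U : Set (EuclideanSpace ℝ (Fin n))) : ℝ :=
  sInf {R : ℝ | ∃ f : EuclideanSpace ℝ (Fin n) → ℝ,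
    ContDiff ℝ (⊤ : ℕ∞) f ∧ HasCompactSupport f ∧ tsupport f ⊆ U ∧ f ≠ 0 ∧
    R = (∫ x, ‖fderiv ℝ f x‖ ^ 2) / (∫ x, (f x) ^ 2)}

def annulus (n : ℕ) (a b : ℝ) : Set (EuclideanSpace ℝ (Fin n)) :=
  {x | a < ‖x‖ ∧ ‖x‖ < b}

theorem integral_fderiv_apply_self {n : ℕ} {u : EuclideanSpace ℝ (Fin n) → ℝ}
    (hu : ContDiff ℝ 1 u) (hc : HasCompactSupport u) :
    ∫ x, fderiv ℝ u x x = -(n * ∫ x, u x) := by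
  have hcoord (i : Fin n) :
      Integrable (fun x : EuclideanSpace ℝ (Fin n) =>
        x i * fderiv ℝ u x (EuclideanSpace.single i 1)) ∧
      ∫ x : EuclideanSpace ℝ (Fin n), x i * fderiv ℝ u x (EuclideanSpace.single i 1) =
        -∫ x, u x := by
    have hd : Continuous (fun x => fderiv ℝ u x (EuclideanSpace.single i 1)) :=
      (hu.continuous_fderiv one_ne_zero).clm_apply continuous_const
    have hdc : HasCompactSupport (fun x => fderiv ℝ u x (EuclideanSpace.single i 1)) :=
      hc.fderiv_apply ℝ _
    have hp (x : EuclideanSpace ℝ (Fin n)) :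
        HasFDerivAt (fun y : EuclideanSpace ℝ (Fin n) => y i)
          (EuclideanSpace.proj i : EuclideanSpace ℝ (Fin n) →L[ℝ] ℝ) x :=
      (EuclideanSpace.proj i : EuclideanSpace ℝ (Fin n) →L[ℝ] ℝ).hasFDerivAt
    have hpc : Continuous (fun y : EuclideanSpace ℝ (Fin n) => y i) := by fun_prop
    have h1 : Integrable (fun x : EuclideanSpace ℝ (Fin n) =>
        x i * fderiv ℝ u x (EuclideanSpace.single i 1)) :=
      (hpc.mul hd).integrable_of_hasCompactSupport hdc.mul_left
    refine ⟨h1, ?_⟩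
    have hone (x : EuclideanSpace ℝ (Fin n)) :
        fderiv ℝ (fun y : EuclideanSpace ℝ (Fin n) => y i) x (EuclideanSpace.single i 1) = 1 := by
      rw [(hp x).fderiv]; simp
    rw [integral_mul_fderiv_eq_neg_fderiv_mul_of_integrable _ h1
      ((hpc.mul hu.continuous).integrable_of_hasCompactSupport hc.mul_left)
      (fun x _ => (hp x).differentiableAt)
      (fun x _ => (hu.differentiable one_ne_zero).differentiableAt)]
    · simp [hone]
    · simpa [hone] using hu.continuous.integrable_of_hasCompactSupport hc
  have hsum (x : EuclideanSpace ℝ (Fin n)) :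
      fderiv ℝ u x x = ∑ i, x i * fderiv ℝ u x (EuclideanSpace.single i 1) :=
    (congrArg (fderiv ℝ u x) ((EuclideanSpace.basisFun (Fin n) ℝ).sum_repr x).symm).trans
      (by simp [map_sum])
  simp_rw [hsum]
  rw [integral_finsetSum _ fun i _ => (hcoord i).1]
  simp [(hcoord _).2]

theorem hasFDerivAt_norm_of_ne_zero {E : Type*} [NormedAddCommGroup E] [InnerProductSpace ℝ E]
    {x : E} (hx : x ≠ 0) : HasFDerivAt (norm : E → ℝ) (‖x‖⁻¹ • innerSL ℝ x) x := by
  have h := (hasStrictFDerivAt_norm_sq x).hasFDerivAt.sqrt (by simpa using hx)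
  simp only [Real.sqrt_sq (norm_nonneg _)] at h
  convert h using 1
  ext v
  simp
  field_simp

theorem norm_sq_smul_innerSL_add {E : Type*} [NormedAddCommGroup E] [InnerProductSpace ℝ E]
    [CompleteSpace E] (c d : ℝ) (x : E) (A : E →L[ℝ] ℝ) :
    ‖c • innerSL ℝ x + d • A‖ ^ 2 = c ^ 2 * ‖x‖ ^ 2 + 2 * c * d * A x + d ^ 2 * ‖A‖ ^ 2 := by
  obtain ⟨g, rfl⟩ := (InnerProductSpace.toDual ℝ E).surjective A
  have h : c • innerSL ℝ x + d • InnerProductSpace.toDual ℝ E g =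
      InnerProductSpace.toDual ℝ E (c • x + d • g) := by
    ext v; simp
  rw [h, LinearIsometryEquiv.norm_map, LinearIsometryEquiv.norm_map, norm_add_sq_real]
  simp [norm_smul, mul_pow, inner_smul_left, inner_smul_right, real_inner_comm]
  ring


theorem contDiff_mul_of_tsupport {E : Type*} [NormedAddCommGroup E] [NormedSpace ℝ E]
    {k : WithTop ℕ∞} {g h : E → ℝ} (hh : ContDiff ℝ k h)
    (hg : ∀ x ∈ tsupport h, ContDiffAt ℝ k g x) : ContDiff ℝ k (fun x => g x * h x) := by
  refine contDiff_iff_contDiffAt.2 fun x => ?_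
  by_cases hx : x ∈ tsupport h
  · exact (hg x hx).mul hh.contDiffAt
  · refine (contDiffAt_const (c := (0 : ℝ))).congr_of_eventuallyEq ?_
    filter_upwards [notMem_tsupport_iff_eventuallyEq.1 hx] with y hy
    simp [hy]

theorem integrable_norm_fderiv_sq {E : Type*} [NormedAddCommGroup E] [NormedSpace ℝ E]
    [MeasurableSpace E] [BorelSpace E] {μ : Measure E} [IsFiniteMeasureOnCompacts μ]
    {h : E → ℝ} (hh : ContDiff ℝ 1 h) (hc : HasCompactSupport h) :
    Integrable (fun x => ‖fderiv ℝ h x‖ ^ 2) μ := by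
  refine ((hh.continuous_fderiv one_ne_zero).norm.pow 2).integrable_of_hasCompactSupport ?_
  refine (hc.fderiv ℝ).mono fun x hx => ?_
  contrapose! hx
  simp_all

theorem energy_radial_mul {n : ℕ} {Φ Φ₁ Φ₂ q : ℝ → ℝ}
    (hΦ : ∀ r, 0 < r → HasDerivAt Φ (Φ₁ r) r) (hΦ₁ : ∀ r, 0 < r → HasDerivAt Φ₁ (Φ₂ r) r)
    (sΦ : ∀ r, 0 < r → ContDiffAt ℝ 1 Φ r) (sΦ₁ : ∀ r, 0 < r → ContDiffAt ℝ 1 Φ₁ r)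
    (hq : ∀ r, 0 < r → Φ₂ r + (n - 1) * Φ₁ r / r = -(q r * Φ r))
    {h : EuclideanSpace ℝ (Fin n) → ℝ} (hh : ContDiff ℝ 1 h) (hc : HasCompactSupport h)
    (h0 : 0 ∉ tsupport h) :
    Integrable (fun x => Φ ‖x‖ ^ 2 * ‖fderiv ℝ h x‖ ^ 2) ∧
    Integrable (fun x => q ‖x‖ * (Φ ‖x‖ * h x) ^ 2) ∧
    ∫ x, ‖fderiv ℝ (fun y => Φ ‖y‖ * h y) x‖ ^ 2 =
      (∫ x, Φ ‖x‖ ^ 2 * ‖fderiv ℝ h x‖ ^ 2) + ∫ x, q ‖x‖ * (Φ ‖x‖ * h x) ^ 2 := by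
  have hne {x : EuclideanSpace ℝ (Fin n)} (hx : x ∈ tsupport h) : x ≠ 0 := by
    rintro rfl; exact h0 hx
  set G : ℝ → ℝ := fun r => Φ r * Φ₁ r / r with hG
  set u : EuclideanSpace ℝ (Fin n) → ℝ := fun x => G ‖x‖ * h x * h x with hu
  have hdG (r : ℝ) (hr : 0 < r) :
      HasDerivAt G ((Φ₁ r ^ 2 + Φ r * Φ₂ r) / r - Φ r * Φ₁ r / r ^ 2) r := by
    refine (((hΦ r hr).mul (hΦ₁ r hr)).div (hasDerivAt_id r) hr.ne').congr_deriv ?_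
    simp
    field_simp
  have hprod : ContDiff ℝ 1 (fun x => Φ ‖x‖ * h x) :=
    contDiff_mul_of_tsupport hh fun x hx =>
      (sΦ _ (norm_pos_iff.2 (hne hx))).comp x (contDiffAt_norm ℝ (hne hx))
  have hus : ContDiff ℝ 1 u := by
    refine ContDiff.mul (contDiff_mul_of_tsupport hh fun x hx => ?_) hh
    have hx := hne hx
    exact (((sΦ _ (norm_pos_iff.2 hx)).mul (sΦ₁ _ (norm_pos_iff.2 hx))).div contDiffAt_id
      (norm_ne_zero_iff.2 hx)).comp x (contDiffAt_norm ℝ hx)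
  have huc : HasCompactSupport u := hc.mul_left
  have i1 := integrable_norm_fderiv_sq (μ := volume) hprod hc.mul_left
  have i2 : Integrable (fun x => Φ ‖x‖ ^ 2 * ‖fderiv ℝ h x‖ ^ 2) := by
    have hcont : Continuous fun x => Φ ‖x‖ ^ 2 * ‖fderiv ℝ h x‖ ^ 2 := by
      refine continuous_iff_continuousAt.2 fun x => ?_
      by_cases hx : x ∈ tsupport h
      · exact (((sΦ _ (norm_pos_iff.2 (hne hx))).continuousAt.comp
          continuous_norm.continuousAt).pow 2).mul
            ((hh.continuous_fderiv one_ne_zero).norm.pow 2).continuousAt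
      · refine (continuousAt_const (y := (0 : ℝ))).congr ?_
        filter_upwards [(notMem_tsupport_iff_eventuallyEq.1 hx).fderiv (𝕜 := ℝ)] with y hy
        simp [hy]
    refine hcont.integrable_of_hasCompactSupport ((hc.fderiv ℝ).mono fun x hx => ?_)
    contrapose! hx
    simp_all
  have i3 : Integrable u := hus.continuous.integrable_of_hasCompactSupport huc
  have i4 : Integrable (fun x => fderiv ℝ u x x) := by
    refine ((hus.continuous_fderiv one_ne_zero).clm_apply
      continuous_id).integrable_of_hasCompactSupport ((huc.fderiv ℝ).mono fun x hx => ?_)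
    contrapose! hx
    simp_all
  have key (x : EuclideanSpace ℝ (Fin n)) : q ‖x‖ * (Φ ‖x‖ * h x) ^ 2 =
      ‖fderiv ℝ (fun y => Φ ‖y‖ * h y) x‖ ^ 2 - Φ ‖x‖ ^ 2 * ‖fderiv ℝ h x‖ ^ 2 -
        (fderiv ℝ u x x + n * u x) := by
    by_cases hx : x ∈ tsupport h
    · have hx := hne hx
      have hr : 0 < ‖x‖ := norm_pos_iff.2 hx
      have dh : HasFDerivAt h (fderiv ℝ h x) x := (hh.differentiable one_ne_zero x).hasFDerivAt
      have dn := hasFDerivAt_norm_of_ne_zero hx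
      have d1 := ((hΦ _ hr).comp_hasFDerivAt x dn).mul dh
      have d2 := (((hdG _ hr).comp_hasFDerivAt x dn).mul dh).mul dh
      have e1 : fderiv ℝ (fun y => Φ ‖y‖ * h y) x =
          (h x * Φ₁ ‖x‖ * ‖x‖⁻¹) • innerSL ℝ x + Φ ‖x‖ • fderiv ℝ h x := by
        refine d1.fderiv.trans ?_
        ext v
        simp
        ring
      have e2 : fderiv ℝ u x x = _ := congrArg (fun L => L x) d2.fderiv
      have e3 : Φ₂ ‖x‖ = -(q ‖x‖ * Φ ‖x‖) - (n - 1) * Φ₁ ‖x‖ / ‖x‖ := by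
        linarith [hq _ hr]
      rw [e1, norm_sq_smul_innerSL_add, e2]
      simp [e3, hu, hG]
      field_simp
      ring
    · have hev := notMem_tsupport_iff_eventuallyEq.1 hx
      have z1 : (fun y => Φ ‖y‖ * h y) =ᶠ[nhds x] 0 := by
        filter_upwards [hev] with y hy; simp [hy]
      have z2 : u =ᶠ[nhds x] 0 := by
        filter_upwards [hev] with y hy; simp [hu, hy]
      simp [z1.fderiv_eq, z2.fderiv_eq, hev.fderiv_eq, z2.eq_of_nhds, hev.eq_of_nhds]
  refine ⟨i2, ?_, ?_⟩
  · simp_rw [key]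
    exact (i1.sub i2).sub (i4.add (i3.const_mul _))
  · have i5 : Integrable (fun x => ‖fderiv ℝ (fun y => Φ ‖y‖ * h y) x‖ ^ 2 -
        Φ ‖x‖ ^ 2 * ‖fderiv ℝ h x‖ ^ 2) := i1.sub i2
    have i6 : Integrable (fun x => fderiv ℝ u x x + n * u x) := i4.add (i3.const_mul _)
    simp_rw [key]
    rw [integral_sub i5 i6, integral_sub i1 i2, integral_add i4 (i3.const_mul _),
      integral_const_mul, integral_fderiv_apply_self hus huc]
    ring

theorem deriv_smoothTransition_of_one_lt {y : ℝ} (h : 1 < y) : deriv smoothTransition y = 0 := by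
  have : smoothTransition =ᶠ[nhds y] fun _ => 1 := by
    filter_upwards [Ioi_mem_nhds h] with z hz using smoothTransition.one_of_one_le (le_of_lt hz)
  simp [this.deriv_eq]

theorem exists_bound_add_one_mul_deriv_smoothTransition :
    ∃ M : ℝ, ∀ y : ℝ, |(y + 1) * deriv smoothTransition y| ≤ M := by
  have hc : Continuous fun y : ℝ => (y + 1) * deriv smoothTransition y :=
    (continuous_id.add continuous_const).mul
      ((smoothTransition.contDiff (n := 1)).continuous_deriv le_rfl)
  obtain ⟨M, hM⟩ := (isCompact_Icc (a := (0 : ℝ)) (b := 1)).exists_bound_of_continuousOn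
    hc.continuousOn
  refine ⟨max M 0, fun y => ?_⟩
  by_cases hy : y ∈ Set.Icc (0 : ℝ) 1
  · exact (hM y hy).trans (le_max_left _ _)
  · have hz : deriv smoothTransition y = 0 := by
      rcases lt_or_ge y 0 with h | h
      · have : smoothTransition =ᶠ[nhds y] fun _ => 0 := by
          filter_upwards [Iio_mem_nhds h] with z hz using
            smoothTransition.zero_of_nonpos (le_of_lt hz)
        simp [this.deriv_eq]
      · have h1 : 1 < y := by
          by_contra h'; exact hy ⟨h, not_lt.1 h'⟩
        exact deriv_smoothTransition_of_one_lt h1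
    simp [hz]

/-- A smooth cutoff on the line, supported in `[a + 1 / m, b - 1 / m]` and equal to `1` on
`[a + 2 / m, b - 2 / m]`. -/
noncomputable def intervalCutoff (a b m r : ℝ) : ℝ :=
  smoothTransition (m * (r - a) - 1) * smoothTransition (m * (b - r) - 1)

theorem intervalCutoff_contDiff (a b m : ℝ) {k : ℕ∞} : ContDiff ℝ k (intervalCutoff a b m) :=
  (smoothTransition.contDiff.comp (by fun_prop)).mul (smoothTransition.contDiff.comp (by fun_prop))

theorem intervalCutoff_nonneg (a b m r : ℝ) : 0 ≤ intervalCutoff a b m r :=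
  mul_nonneg (smoothTransition.nonneg _) (smoothTransition.nonneg _)

theorem hasDerivAt_intervalCutoff (a b m r : ℝ) :
    HasDerivAt (intervalCutoff a b m)
      (m * deriv smoothTransition (m * (r - a) - 1) * smoothTransition (m * (b - r) - 1) -
        smoothTransition (m * (r - a) - 1) * (m * deriv smoothTransition (m * (b - r) - 1))) r := by
  have hT (y : ℝ) : HasDerivAt smoothTransition (deriv smoothTransition y) y :=
    ((smoothTransition.contDiff (n := 1)).differentiable one_ne_zero y).hasDerivAt
  have h1 : HasDerivAt (fun r : ℝ => m * (r - a) - 1) m r := by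
    simpa using (((hasDerivAt_id r).sub_const a).const_mul m).sub_const 1
  have h2 : HasDerivAt (fun r : ℝ => m * (b - r) - 1) (-m) r := by
    simpa using (((hasDerivAt_id r).const_sub b).const_mul m).sub_const 1
  refine (((hT _).comp r h1).mul ((hT _).comp r h2)).congr_deriv ?_
  simp only [Function.comp_apply]
  ring

theorem intervalCutoff_ne_zero {a b m r : ℝ} (hm : 0 < m) (h : intervalCutoff a b m r ≠ 0) :
    a + 1 / m < r ∧ r < b - 1 / m := by
  have h1 := left_ne_zero_of_mul h
  have h2 := right_ne_zero_of_mul h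
  rw [Ne, smoothTransition.zero_iff_nonpos, not_le] at h1 h2
  constructor
  · have : 1 / m < r - a := by rw [div_lt_iff₀ hm]; linarith
    linarith
  · have : 1 / m < b - r := by rw [div_lt_iff₀ hm]; linarith
    linarith

theorem intervalCutoff_mono {a b m m' r : ℝ} (hm : 0 < m) (hmm : m ≤ m') :
    intervalCutoff a b m r ≤ intervalCutoff a b m' r := by
  by_cases h : intervalCutoff a b m r = 0
  · exact h ▸ intervalCutoff_nonneg a b m' r
  · obtain ⟨h1, h2⟩ := intervalCutoff_ne_zero hm h
    have h0 : 0 < 1 / m := by positivity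
    have ha : 0 ≤ r - a := by linarith
    have hb : 0 ≤ b - r := by linarith
    exact mul_le_mul (smoothTransition.monotone (by nlinarith))
      (smoothTransition.monotone (by nlinarith)) (smoothTransition.nonneg _)
      (smoothTransition.nonneg _)

theorem tsupport_intervalCutoff_norm_subset {E : Type*} [NormedAddCommGroup E] {a b m : ℝ}
    (hm : 0 < m) : tsupport (fun x : E => intervalCutoff a b m ‖x‖) ⊆ {x | a < ‖x‖ ∧ ‖x‖ < b} := by
  have hcl : IsClosed {x : E | a + 1 / m ≤ ‖x‖ ∧ ‖x‖ ≤ b - 1 / m} :=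
    (isClosed_le continuous_const continuous_norm).inter
      (isClosed_le continuous_norm continuous_const)
  have h0 : 0 < 1 / m := by positivity
  refine (closure_minimal (fun x hx => ?_) hcl).trans fun x hx => ⟨?_, ?_⟩
  · have := intervalCutoff_ne_zero hm hx
    exact ⟨this.1.le, this.2.le⟩
  · linarith [hx.1]
  · linarith [hx.2]

theorem hasCompactSupport_of_tsupport_subset_annulus {E : Type*} [NormedAddCommGroup E]
    [ProperSpace E] {a b : ℝ} {f : E → ℝ} (h : tsupport f ⊆ {x | a < ‖x‖ ∧ ‖x‖ < b}) :
    HasCompactSupport f :=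
  (isCompact_closedBall (0 : E) b).of_isClosed_subset (isClosed_tsupport f) fun x hx => by
    simpa using (h hx).2.le

theorem intervalCutoff_norm_contDiff {E : Type*} [NormedAddCommGroup E] [InnerProductSpace ℝ E]
    {a b m : ℝ} (ha : 0 < a) (hm : 0 < m) {k : ℕ∞} :
    ContDiff ℝ k (fun x : E => intervalCutoff a b m ‖x‖) := by
  refine contDiff_iff_contDiffAt.2 fun x => ?_
  by_cases hx : x = 0
  · have hx' : x ∉ tsupport (fun x : E => intervalCutoff a b m ‖x‖) := fun h => by
      have := (tsupport_intervalCutoff_norm_subset hm h).1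
      simp only [hx, norm_zero] at this
      linarith
    exact (contDiffAt_const (c := (0 : ℝ))).congr_of_eventuallyEq
      (notMem_tsupport_iff_eventuallyEq.1 hx')
  · exact (intervalCutoff_contDiff a b m).contDiffAt.comp x (contDiffAt_norm ℝ hx)

theorem norm_fderiv_comp_norm {E : Type*} [NormedAddCommGroup E] [InnerProductSpace ℝ E]
    {g : ℝ → ℝ} {g' : ℝ} {x : E} (hx : x ≠ 0) (hg : HasDerivAt g g' ‖x‖) :
    ‖fderiv ℝ (fun y => g ‖y‖) x‖ = |g'| := by
  have h := hg.comp_hasFDerivAt x (hasFDerivAt_norm_of_ne_zero hx)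
  rw [show (fun y : E => g ‖y‖) = g ∘ norm from rfl, h.fderiv, norm_smul, norm_smul,
    innerSL_apply_norm]
  simp [hx]

/-- The radial profile `r ^ α * sin (k * (r - a))`. -/
noncomputable def radialSine (α k a r : ℝ) : ℝ := r ^ α * sin (k * (r - a))

/-- The derivative of `radialSine` on the positive half-line. -/
noncomputable def radialSineDeriv (α k a r : ℝ) : ℝ :=
  α * (r ^ α * sin (k * (r - a))) / r + k * (r ^ α * cos (k * (r - a)))

theorem hasDerivAt_rpow_div (α : ℝ) {r : ℝ} (hr : 0 < r) :
    HasDerivAt (fun r : ℝ => r ^ α) (α * r ^ α / r) r := by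
  refine (Real.hasDerivAt_rpow_const (p := α) (Or.inl hr.ne')).congr_deriv ?_
  rw [Real.rpow_sub_one hr.ne']
  ring

theorem hasDerivAt_sin_mul_sub (k a r : ℝ) :
    HasDerivAt (fun r : ℝ => sin (k * (r - a))) (k * cos (k * (r - a))) r := by
  have h1 : HasDerivAt (fun r : ℝ => k * (r - a)) k r := by
    simpa using ((hasDerivAt_id r).sub_const a).const_mul k
  exact h1.sin.congr_deriv (mul_comm _ _)

theorem hasDerivAt_cos_mul_sub (k a r : ℝ) :
    HasDerivAt (fun r : ℝ => cos (k * (r - a))) (-(k * sin (k * (r - a)))) r := by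
  have h1 : HasDerivAt (fun r : ℝ => k * (r - a)) k r := by
    simpa using ((hasDerivAt_id r).sub_const a).const_mul k
  exact h1.cos.congr_deriv (by ring)

theorem hasDerivAt_radialSine (α k a : ℝ) {r : ℝ} (hr : 0 < r) :
    HasDerivAt (radialSine α k a) (radialSineDeriv α k a r) r := by
  refine ((hasDerivAt_rpow_div α hr).mul (hasDerivAt_sin_mul_sub k a r)).congr_deriv ?_
  simp only [radialSineDeriv]
  ring

theorem hasDerivAt_radialSineDeriv (α k a : ℝ) {r : ℝ} (hr : 0 < r) :
    HasDerivAt (radialSineDeriv α k a)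
      (α * (α - 1) * (r ^ α * sin (k * (r - a))) / r ^ 2 +
        2 * α * k * (r ^ α * cos (k * (r - a))) / r - k ^ 2 * (r ^ α * sin (k * (r - a)))) r := by
  have hs := (hasDerivAt_rpow_div α hr).mul (hasDerivAt_sin_mul_sub k a r)
  have hc := (hasDerivAt_rpow_div α hr).mul (hasDerivAt_cos_mul_sub k a r)
  refine (((hs.const_mul α).div (hasDerivAt_id r) hr.ne').add (hc.const_mul k)).congr_deriv ?_
  simp only [id_eq, Pi.mul_apply]
  field_simp
  ring

theorem contDiffAt_radialSine (α k a : ℝ) {r : ℝ} (hr : 0 < r) {l : ℕ∞} :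
    ContDiffAt ℝ l (radialSine α k a) r :=
  (Real.contDiffAt_rpow_const_of_ne hr.ne').mul (by fun_prop)

theorem contDiffAt_radialSineDeriv (α k a : ℝ) {r : ℝ} (hr : 0 < r) {l : ℕ∞} :
    ContDiffAt ℝ l (radialSineDeriv α k a) r := by
  have hp : ContDiffAt ℝ l (fun r : ℝ => r ^ α) r := Real.contDiffAt_rpow_const_of_ne hr.ne'
  have hs : ContDiffAt ℝ l (fun r : ℝ => sin (k * (r - a))) r := by fun_prop
  have hc : ContDiffAt ℝ l (fun r : ℝ => cos (k * (r - a))) r := by fun_prop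
  exact ((contDiffAt_const.mul (hp.mul hs)).div contDiffAt_id hr.ne').add
    (contDiffAt_const.mul (hp.mul hc))

theorem energy_radialSine_mul {n : ℕ} (k a : ℝ) {h : EuclideanSpace ℝ (Fin n) → ℝ}
    (hh : ContDiff ℝ 1 h) (hc : HasCompactSupport h) (h0 : 0 ∉ tsupport h) :
    let Φ := radialSine (-((n : ℝ) - 1) / 2) k a
    let q : ℝ → ℝ := fun r => ((n : ℝ) - 3) * (n - 1) / (4 * r ^ 2) + k ^ 2
    Integrable (fun x => Φ ‖x‖ ^ 2 * ‖fderiv ℝ h x‖ ^ 2) ∧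
    Integrable (fun x => q ‖x‖ * (Φ ‖x‖ * h x) ^ 2) ∧
    ∫ x, ‖fderiv ℝ (fun y => Φ ‖y‖ * h y) x‖ ^ 2 =
      (∫ x, Φ ‖x‖ ^ 2 * ‖fderiv ℝ h x‖ ^ 2) + ∫ x, q ‖x‖ * (Φ ‖x‖ * h x) ^ 2 := by
  intro Φ q
  refine energy_radial_mul (fun r hr => hasDerivAt_radialSine _ k a hr)
    (fun r hr => hasDerivAt_radialSineDeriv _ k a hr)
    (fun r hr => contDiffAt_radialSine (l := 1) _ k a hr)
    (fun r hr => contDiffAt_radialSineDeriv (l := 1) _ k a hr) (fun r hr => ?_) hh hc h0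
  simp only [q, radialSine, radialSineDeriv]
  field_simp
  ring

theorem radialSine_pos {α a b r : ℝ} (ha : 0 < a) (har : a < r) (hrb : r < b) :
    0 < radialSine α (π / (b - a)) a r := by
  have hba : 0 < b - a := by linarith
  refine mul_pos (rpow_pos_of_pos (ha.trans har) _) (sin_pos_of_pos_of_lt_pi ?_ ?_)
  · exact mul_pos (div_pos pi_pos hba) (by linarith)
  · rw [div_mul_eq_mul_div, div_lt_iff₀ hba]
    nlinarith [pi_pos]

theorem exists_bound_radialSine_mul_deriv_intervalCutoff {α a b : ℝ} (hα : α ≤ 0) (ha : 0 < a)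
    (hab : a < b) : ∃ C : ℝ, ∀ m r : ℝ, 0 < m → a < r → r < b →
      |radialSine α (π / (b - a)) a r * deriv (intervalCutoff a b m) r| ≤ C := by
  obtain ⟨M, hM⟩ := exists_bound_add_one_mul_deriv_smoothTransition
  set k := π / (b - a) with hk
  have hba : 0 < b - a := by linarith
  have hk0 : 0 < k := div_pos pi_pos hba
  refine ⟨a ^ α * (k * M + k * M), fun m r hm har hrb => ?_⟩
  set s := sin (k * (r - a)) with hs
  have hs1 : |s| ≤ k * (r - a) :=
    (abs_sin_le_abs).trans_eq (abs_of_pos (mul_pos hk0 (by linarith)))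
  have hs2 : |s| ≤ k * (b - r) := by
    have : s = sin (k * (b - r)) := by
      rw [hs, ← sin_pi_sub]
      congr 1
      have : k * (b - a) = π := by rw [hk]; field_simp
      linear_combination -this
    rw [this]
    exact (abs_sin_le_abs).trans_eq (abs_of_pos (mul_pos hk0 (by linarith)))
  have hp : r ^ α ≤ a ^ α := rpow_le_rpow_of_nonpos ha har.le hα
  have hp0 : 0 ≤ r ^ α := rpow_nonneg (ha.trans har).le _
  have bound (t T d : ℝ) (ht : 0 < t) (hst : |s| ≤ k * t) (hT0 : 0 ≤ T) (hT1 : T ≤ 1)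
      (hd : |m * t * d| ≤ M) : |s * (m * d * T)| ≤ k * M := by
    rw [abs_mul, abs_mul _ T, abs_of_nonneg hT0]
    calc |s| * (|m * d| * T) ≤ (k * t) * (|m * d| * 1) := by gcongr
      _ = k * |m * t * d| := by
        rw [show m * t * d = t * (m * d) by ring, abs_mul t, abs_of_pos ht]; ring
      _ ≤ k * M := by gcongr
  have b1 := bound (r - a) (smoothTransition (m * (b - r) - 1))
    (deriv smoothTransition (m * (r - a) - 1)) (by linarith) hs1 (smoothTransition.nonneg _)
    (smoothTransition.le_one _) (by simpa using hM (m * (r - a) - 1))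
  have b2 := bound (b - r) (smoothTransition (m * (r - a) - 1))
    (deriv smoothTransition (m * (b - r) - 1)) (by linarith) hs2 (smoothTransition.nonneg _)
    (smoothTransition.le_one _) (by simpa using hM (m * (b - r) - 1))
  rw [(hasDerivAt_intervalCutoff a b m r).deriv, radialSine, mul_assoc, abs_mul,
    abs_of_nonneg hp0]
  refine mul_le_mul hp ?_ (abs_nonneg _) (rpow_nonneg ha.le _)
  rw [mul_sub, mul_comm (smoothTransition (m * (r - a) - 1))]
  exact (abs_sub _ _).trans (add_le_add b1 b2)

theorem tendsto_integral_radialSine_sq_mul_norm_fderiv_intervalCutoff_sq {n : ℕ} {α a b : ℝ}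
    (hα : α ≤ 0) (ha : 0 < a) (hab : a < b)
    (hmeas : ∀ m : ℕ, AEStronglyMeasurable (fun x : EuclideanSpace ℝ (Fin n) =>
      radialSine α (π / (b - a)) a ‖x‖ ^ 2 *
        ‖fderiv ℝ (fun y => intervalCutoff a b (m + 1) ‖y‖) x‖ ^ 2)) :
    Filter.Tendsto (fun m : ℕ => ∫ x : EuclideanSpace ℝ (Fin n),
      radialSine α (π / (b - a)) a ‖x‖ ^ 2 *
        ‖fderiv ℝ (fun y => intervalCutoff a b (m + 1) ‖y‖) x‖ ^ 2) Filter.atTop (nhds 0) := by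
  obtain ⟨C, hC⟩ := exists_bound_radialSine_mul_deriv_intervalCutoff hα ha hab
  have hm (m : ℕ) : (0 : ℝ) < m + 1 := by positivity
  have hin (m : ℕ) (x : EuclideanSpace ℝ (Fin n)) (hx : a < ‖x‖) :
      ‖fderiv ℝ (fun y => intervalCutoff a b (m + 1) ‖y‖) x‖ =
        |deriv (intervalCutoff a b (m + 1)) ‖x‖| := by
    rw [norm_fderiv_comp_norm (norm_pos_iff.1 (ha.trans hx)) (hasDerivAt_intervalCutoff _ _ _ _),
      (hasDerivAt_intervalCutoff _ _ _ _).deriv]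
  have hout (m : ℕ) (x : EuclideanSpace ℝ (Fin n)) (hx : ¬(a < ‖x‖ ∧ ‖x‖ < b)) :
      fderiv ℝ (fun y => intervalCutoff a b (m + 1) ‖y‖) x = 0 :=
    fderiv_of_notMem_tsupport (𝕜 := ℝ) fun h => hx (tsupport_intervalCutoff_norm_subset (hm m) h)
  rw [← integral_zero (EuclideanSpace ℝ (Fin n)) ℝ]
  refine tendsto_integral_of_dominated_convergence
    ((Metric.closedBall 0 b).indicator fun _ => C ^ 2) hmeas ?_ ?_ ?_
  · exact (integrable_indicator_iff measurableSet_closedBall).2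
      (integrableOn_const (isCompact_closedBall _ _).measure_lt_top.ne)
  · refine fun m => Filter.Eventually.of_forall fun x => ?_
    by_cases hx : a < ‖x‖ ∧ ‖x‖ < b
    · rw [Set.indicator_of_mem (by simpa using hx.2.le), hin m x hx.1, ← mul_pow,
        Real.norm_eq_abs, abs_pow, abs_mul, abs_abs, ← abs_mul]
      exact pow_le_pow_left₀ (abs_nonneg _) (hC _ _ (hm m) hx.1 hx.2) 2
    · simp only [hout m x hx, norm_zero, ne_eq, OfNat.ofNat_ne_zero, not_false_eq_true, zero_pow,
        mul_zero]
      exact Set.indicator_nonneg (fun _ _ => sq_nonneg C) x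
  · refine Filter.Eventually.of_forall fun x => ?_
    by_cases hx : a < ‖x‖ ∧ ‖x‖ < b
    · have ht : Filter.Tendsto (fun m : ℕ => (m : ℝ) + 1) Filter.atTop Filter.atTop :=
        Filter.tendsto_atTop_add_const_right _ _ tendsto_natCast_atTop_atTop
      refine tendsto_const_nhds.congr' ?_
      filter_upwards [(ht.atTop_mul_const (sub_pos.2 hx.1)).eventually_gt_atTop 2,
        (ht.atTop_mul_const (sub_pos.2 hx.2)).eventually_gt_atTop 2] with m h1 h2
      rw [hin m x hx.1, (hasDerivAt_intervalCutoff _ _ _ _).deriv,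
        deriv_smoothTransition_of_one_lt (by linarith),
        deriv_smoothTransition_of_one_lt (by linarith)]
      simp
    · simp [hout _ x hx]

theorem dirichletEigenvalue_bddBelow (n : ℕ) (U : Set (EuclideanSpace ℝ (Fin n))) :
    BddBelow {R : ℝ | ∃ f : EuclideanSpace ℝ (Fin n) → ℝ,
      ContDiff ℝ (⊤ : ℕ∞) f ∧ HasCompactSupport f ∧ tsupport f ⊆ U ∧ f ≠ 0 ∧
      R = (∫ x, ‖fderiv ℝ f x‖ ^ 2) / (∫ x, (f x) ^ 2)} := by
  refine ⟨0, ?_⟩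
  rintro R ⟨f, -, -, -, -, rfl⟩
  exact div_nonneg (integral_nonneg fun x => sq_nonneg _) (integral_nonneg fun x => sq_nonneg _)

theorem integrable_sq_of_hasCompactSupport {E : Type*} [TopologicalSpace E] [MeasurableSpace E]
    [OpensMeasurableSpace E] {μ : Measure E} [IsFiniteMeasureOnCompacts μ] {f : E → ℝ}
    (hf : Continuous f) (hc : HasCompactSupport f) : Integrable (fun x => f x ^ 2) μ :=
  (hf.pow 2).integrable_of_hasCompactSupport <| hc.mono fun x hx => by
    contrapose! hx
    simp_all

theorem integral_sq_pos_of_ne_zero {n : ℕ} {f : EuclideanSpace ℝ (Fin n) → ℝ} (hf : Continuous f)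
    (hc : HasCompactSupport f) (h0 : f ≠ 0) : 0 < ∫ x, f x ^ 2 := by
  obtain ⟨x, hx⟩ := Function.ne_iff.1 h0
  refine (hf.pow 2).integral_pos_of_hasCompactSupport_nonneg_nonzero (x := x) ?_
    (fun y => sq_nonneg _) (by simpa using hx)
  exact hc.comp_left (g := fun t : ℝ => t ^ 2) (by simp)

theorem le_rayleigh_quotient_annulus {n : ℕ} (hn : 3 ≤ n) {a b : ℝ} (ha : 0 < a)
    {f : EuclideanSpace ℝ (Fin n) → ℝ} (hf : ContDiff ℝ 1 f) (hU : tsupport f ⊆ annulus n a b)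
    (h0 : f ≠ 0) :
    ((n : ℝ) - 3) * ((n : ℝ) - 1) / (4 * b ^ 2) + π ^ 2 / (b - a) ^ 2 ≤
      (∫ x, ‖fderiv ℝ f x‖ ^ 2) / (∫ x, (f x) ^ 2) := by
  have hc : HasCompactSupport f := hasCompactSupport_of_tsupport_subset_annulus hU
  set Φ := radialSine (-((n : ℝ) - 1) / 2) (π / (b - a)) a with hΦ
  have hpos {x : EuclideanSpace ℝ (Fin n)} (hx : x ∈ tsupport f) : 0 < Φ ‖x‖ :=
    radialSine_pos ha (hU hx).1 (hU hx).2
  set h : EuclideanSpace ℝ (Fin n) → ℝ := fun x => (Φ ‖x‖)⁻¹ * f x with hh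
  have hhs : ContDiff ℝ 1 h := contDiff_mul_of_tsupport hf fun x hx => by
    have hx0 : 0 < ‖x‖ := ha.trans (hU hx).1
    exact ((contDiffAt_radialSine (l := 1) _ _ _ hx0).comp x
      (contDiffAt_norm ℝ (norm_pos_iff.1 hx0))).inv (hpos hx).ne'
  have hsub : tsupport h ⊆ tsupport f := tsupport_mul_subset_right
  have h00 : (0 : EuclideanSpace ℝ (Fin n)) ∉ tsupport h := fun h => by
    have := (hU (hsub h)).1
    rw [norm_zero] at this
    linarith
  have hfe : f = fun x => Φ ‖x‖ * h x := by
    ext x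
    by_cases hx : x ∈ tsupport f
    · simp [hh, (hpos hx).ne']
    · simp [hh, image_eq_zero_of_notMem_tsupport hx]
  obtain ⟨-, hint, he⟩ := energy_radialSine_mul (π / (b - a)) a hhs hc.mul_left h00
  simp only [← hΦ] at hint he
  simp only [← congrFun hfe] at hint he
  rw [le_div_iff₀ (integral_sq_pos_of_ne_zero hf.continuous hc h0), he, ← integral_const_mul]
  have hN : 0 ≤ ∫ x, Φ ‖x‖ ^ 2 * ‖fderiv ℝ h x‖ ^ 2 := integral_nonneg fun x => by positivity
  refine le_add_of_nonneg_of_le hN (integral_mono_of_nonneg ?_ hint ?_)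
  all_goals have hn' : (3 : ℝ) ≤ n := by exact_mod_cast hn
  all_goals have hn'' : 0 ≤ ((n : ℝ) - 3) * (n - 1) := mul_nonneg (by linarith) (by linarith)
  · exact Filter.Eventually.of_forall fun x => by positivity
  · refine Filter.Eventually.of_forall fun x => ?_
    by_cases hx : x ∈ tsupport f
    · have hx0 : 0 < ‖x‖ := ha.trans (hU hx).1
      have hxb : ‖x‖ ≤ b := (hU hx).2.le
      simp only [div_pow]
      gcongr
    · simp [image_eq_zero_of_notMem_tsupport hx]

theorem energy_radialSine_mul_le {n : ℕ} (hn : 3 ≤ n) {a b : ℝ} (ha : 0 < a)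
    {h : EuclideanSpace ℝ (Fin n) → ℝ} (hh : ContDiff ℝ (⊤ : ℕ∞) h)
    (hU : tsupport h ⊆ annulus n a b) :
    let Φ := radialSine (-((n : ℝ) - 1) / 2) (π / (b - a)) a
    ContDiff ℝ (⊤ : ℕ∞) (fun x => Φ ‖x‖ * h x) ∧
    Integrable (fun x => Φ ‖x‖ ^ 2 * ‖fderiv ℝ h x‖ ^ 2) ∧
    ∫ x, ‖fderiv ℝ (fun y => Φ ‖y‖ * h y) x‖ ^ 2 ≤
      (∫ x, Φ ‖x‖ ^ 2 * ‖fderiv ℝ h x‖ ^ 2) +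
        (π ^ 2 / (b - a) ^ 2 + ((n : ℝ) - 3) * ((n : ℝ) - 1) / (4 * a ^ 2)) *
          ∫ x, (Φ ‖x‖ * h x) ^ 2 := by
  intro Φ
  have hn' : (3 : ℝ) ≤ n := by exact_mod_cast hn
  have hn'' : 0 ≤ ((n : ℝ) - 3) * (n - 1) := mul_nonneg (by linarith) (by linarith)
  have hc : HasCompactSupport h := hasCompactSupport_of_tsupport_subset_annulus hU
  have hs : ContDiff ℝ (⊤ : ℕ∞) (fun x => Φ ‖x‖ * h x) :=
    contDiff_mul_of_tsupport hh fun x hx => by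
      have hx0 : 0 < ‖x‖ := ha.trans (hU hx).1
      exact (contDiffAt_radialSine _ _ _ hx0).comp x (contDiffAt_norm ℝ (norm_pos_iff.1 hx0))
  have h0 : (0 : EuclideanSpace ℝ (Fin n)) ∉ tsupport h := fun h => by
    have := (hU h).1
    rw [norm_zero] at this
    linarith
  obtain ⟨hN, hq, hE⟩ := energy_radialSine_mul (π / (b - a)) a (hh.of_le (by simp)) hc h0
  refine ⟨hs, hN, hE.trans_le (add_le_add le_rfl ?_)⟩
  have hcs : HasCompactSupport (fun x => Φ ‖x‖ * h x) := hc.mul_left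
  have hi : Integrable (fun x => (Φ ‖x‖ * h x) ^ 2) :=
    integrable_sq_of_hasCompactSupport hs.continuous hcs
  rw [← integral_const_mul]
  refine integral_mono hq (hi.const_mul _) fun x => ?_
  by_cases hx : x ∈ tsupport h
  · have hxa : a ≤ ‖x‖ := (hU hx).1.le
    simp only [div_pow]
    rw [add_comm (π ^ 2 / (b - a) ^ 2)]
    gcongr
  · simp [image_eq_zero_of_notMem_tsupport hx]

theorem dirichletEigenvalue_annulus_le {n : ℕ} (hn : 3 ≤ n) {a b : ℝ} (ha : 0 < a) (hab : a < b) :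
    (∃ f : EuclideanSpace ℝ (Fin n) → ℝ, ContDiff ℝ (⊤ : ℕ∞) f ∧ HasCompactSupport f ∧
      tsupport f ⊆ annulus n a b ∧ f ≠ 0) ∧
    dirichletEigenvalue n (annulus n a b) ≤
      π ^ 2 / (b - a) ^ 2 + ((n : ℝ) - 3) * ((n : ℝ) - 1) / (4 * a ^ 2) := by
  have hn' : (3 : ℝ) ≤ n := by exact_mod_cast hn
  have hba : 0 < b - a := sub_pos.2 hab
  set Φ := radialSine (-((n : ℝ) - 1) / 2) (π / (b - a)) a with hΦ
  set Z : ℕ → EuclideanSpace ℝ (Fin n) → ℝ := fun m x => intervalCutoff a b (m + 1) ‖x‖ with hZ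
  set F : ℕ → EuclideanSpace ℝ (Fin n) → ℝ := fun m x => Φ ‖x‖ * Z m x with hF
  have hm (m : ℕ) : (0 : ℝ) < m + 1 := by positivity
  have hZU (m : ℕ) : tsupport (Z m) ⊆ annulus n a b := tsupport_intervalCutoff_norm_subset (hm m)
  have hZc (m : ℕ) : HasCompactSupport (Z m) :=
    hasCompactSupport_of_tsupport_subset_annulus (hZU m)
  have hZs (m : ℕ) : ContDiff ℝ (⊤ : ℕ∞) (Z m) := intervalCutoff_norm_contDiff ha (hm m)
  have hE (m : ℕ) := energy_radialSine_mul_le hn ha (hZs m) (hZU m)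
  simp only [← hΦ] at hE
  have hFs (m : ℕ) : ContDiff ℝ (⊤ : ℕ∞) (F m) := (hE m).1
  have hFc (m : ℕ) : HasCompactSupport (F m) := (hZc m).mul_left
  have hFU (m : ℕ) : tsupport (F m) ⊆ annulus n a b := tsupport_mul_subset_right.trans (hZU m)
  obtain ⟨m₀, hm₀⟩ := exists_nat_gt (4 / (b - a))
  rw [div_lt_iff₀ hba] at hm₀
  have : Nontrivial (EuclideanSpace ℝ (Fin n)) := by
    have : Nonempty (Fin n) := ⟨⟨0, by omega⟩⟩
    infer_instance
  obtain ⟨p, hp⟩ := exists_norm_eq (EuclideanSpace ℝ (Fin n)) (c := (a + b) / 2) (by linarith)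
  have hF0 : F m₀ ≠ 0 := fun h => by
    have h1 : F m₀ p = 0 := congrFun h p
    have h2 : Z m₀ p = 1 := by
      simp only [hZ, intervalCutoff, hp]
      rw [smoothTransition.one_of_one_le (by nlinarith),
        smoothTransition.one_of_one_le (by nlinarith), one_mul]
    have h3 : 0 < Φ ‖p‖ := radialSine_pos ha (by linarith) (by linarith)
    simp only [hF, h2, mul_one] at h1
    exact h3.ne' h1
  have hD0 : 0 < ∫ x, F m₀ x ^ 2 :=
    integral_sq_pos_of_ne_zero (hFs m₀).continuous (hFc m₀) hF0
  have hFi (m : ℕ) : Integrable (fun x => F m x ^ 2) :=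
    integrable_sq_of_hasCompactSupport (hFs m).continuous (hFc m)
  have hD (m : ℕ) (hmm : m₀ ≤ m) : ∫ x, F m₀ x ^ 2 ≤ ∫ x, F m x ^ 2 := by
    refine integral_mono (hFi _) (hFi _) fun x => ?_
    have hmm' : (m₀ : ℝ) + 1 ≤ m + 1 := by gcongr
    simp only [hF, mul_pow]
    gcongr
    · exact intervalCutoff_nonneg _ _ _ _
    · exact intervalCutoff_mono (hm m₀) hmm'
  refine ⟨⟨F m₀, hFs m₀, hFc m₀, hFU m₀, hF0⟩, ?_⟩
  set K := π ^ 2 / (b - a) ^ 2 + ((n : ℝ) - 3) * ((n : ℝ) - 1) / (4 * a ^ 2) with hK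
  set N : ℕ → ℝ := fun m => ∫ x, Φ ‖x‖ ^ 2 * ‖fderiv ℝ (Z m) x‖ ^ 2 with hN
  have hlim : Filter.Tendsto N Filter.atTop (nhds 0) :=
    tendsto_integral_radialSine_sq_mul_norm_fderiv_intervalCutoff_sq (by linarith) ha hab
      fun m => (hE m).2.1.aestronglyMeasurable
  have hlim' : Filter.Tendsto (fun m => K + N m / ∫ x, F m₀ x ^ 2) Filter.atTop (nhds K) := by
    simpa using (hlim.div_const (∫ x, F m₀ x ^ 2)).const_add K
  refine ge_of_tendsto hlim' ?_
  filter_upwards [Filter.eventually_ge_atTop m₀] with m hmm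
  have hDm := hD0.trans_le (hD m hmm)
  have hFm : F m ≠ 0 := fun h => by simp [h] at hDm
  refine (csInf_le (dirichletEigenvalue_bddBelow n _)
    ⟨F m, hFs m, hFc m, hFU m, hFm, rfl⟩).trans ?_
  have hN0 : 0 ≤ N m := integral_nonneg fun x => by positivity
  rw [div_le_iff₀ hDm]
  calc ∫ x, ‖fderiv ℝ (F m) x‖ ^ 2
      ≤ N m + K * ∫ x, F m x ^ 2 := (hE m).2.2
    _ = N m / (∫ x, F m₀ x ^ 2) * (∫ x, F m₀ x ^ 2) + K * ∫ x, F m x ^ 2 := by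
        rw [div_mul_cancel₀ _ hD0.ne']
    _ ≤ N m / (∫ x, F m₀ x ^ 2) * (∫ x, F m x ^ 2) + K * ∫ x, F m x ^ 2 :=
        add_le_add (mul_le_mul_of_nonneg_left (hD m hmm) (div_nonneg hN0 hD0.le)) le_rfl
    _ = (K + N m / ∫ x, F m₀ x ^ 2) * ∫ x, F m x ^ 2 := by ring

theorem stmt_1 (n : ℕ) (hn : 3 ≤ n) (a b : ℝ) (ha : 0 < a) (hab : a < b) :
    ((n : ℝ) - 3) * ((n : ℝ) - 1) / (4 * b ^ 2) + π ^ 2 / (b - a) ^ 2 ≤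
        dirichletEigenvalue n (annulus n a b) ∧
    dirichletEigenvalue n (annulus n a b) ≤
        π ^ 2 / (b - a) ^ 2 + ((n : ℝ) - 3) * ((n : ℝ) - 1) / (4 * a ^ 2) := by
  obtain ⟨⟨f, h1, h2, h3, h4⟩, hle⟩ := dirichletEigenvalue_annulus_le hn ha hab
  refine ⟨le_csInf ⟨_, f, h1, h2, h3, h4, rfl⟩ ?_, hle⟩
  rintro R ⟨g, hg, -, hU, hg0, rfl⟩
  exact le_rayleigh_quotient_annulus hn ha (hg.of_le (by simp)) hU hg0
end

section
/- Fix an integer n ≥ 1. There exists a constant C > 0 depending only on n such that for every nonempty bounded open set U ⊆ ℝⁿ and every principal Dirichlet eigenfunction φ of U, one has 1/|U| ≤ (sup_{x∈U} φ(x))² ≤ C·λ(U)^{n/2}, where |U| denotes the Lebesgue measure of U. -/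
open Real MeasureTheory

/-- The Laplacian as the sum of the unmixed second partial derivatives. -/
noncomputable def laplacian {n : ℕ} (φ : EuclideanSpace ℝ (Fin n) → ℝ)
    (x : EuclideanSpace ℝ (Fin n)) : ℝ :=
  ∑ i : Fin n, fderiv ℝ (fun y => fderiv ℝ φ y (EuclideanSpace.single i 1)) x
    (EuclideanSpace.single i 1)

/-- `φ` is a principal Dirichlet eigenfunction of the nonempty bounded open set `U`:
continuous on the closure of `U`, smooth and positive on `U`, vanishing on the boundary,
satisfying `Δφ = -λ(U)·φ` on `U`, and normalized in `L²(U)`. -/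
structure IsPrincipalDirichletEigenfunction {n : ℕ} (U : Set (EuclideanSpace ℝ (Fin n)))
    (φ : EuclideanSpace ℝ (Fin n) → ℝ) : Prop where
  continuousOn : ContinuousOn φ (closure U)
  smooth : ContDiffOn ℝ (⊤ : ℕ∞) φ U
  pos : ∀ x ∈ U, 0 < φ x
  vanishes : ∀ x ∈ frontier U, φ x = 0
  eigenEq : ∀ x ∈ U, laplacian φ x = -(dirichletEigenvalue n U) * φ x
  normalized : (∫ x in U, (φ x) ^ 2) = 1

/-- The unnormalized standard Gaussian on `ℝⁿ`. -/
noncomputable def gaussianKernel {n : ℕ} (y : EuclideanSpace ℝ (Fin n)) : ℝ :=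
  exp (-(1 / 2) * ‖y‖ ^ 2)

section GaussianKernel

variable {n : ℕ}

theorem gaussianKernel_pos (y : EuclideanSpace ℝ (Fin n)) : 0 < gaussianKernel y := exp_pos _

theorem continuous_gaussianKernel :
    Continuous (gaussianKernel : EuclideanSpace ℝ (Fin n) → ℝ) := by
  unfold gaussianKernel
  fun_prop

theorem integrable_exp_neg_mul_sq_norm {b : ℝ} (hb : 0 < b) :
    Integrable (fun y : EuclideanSpace ℝ (Fin n) => exp (-b * ‖y‖ ^ 2)) := by
  apply Integrable.of_integral_ne_zero
  rw [GaussianFourier.integral_rexp_neg_mul_sq_norm hb]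
  positivity

theorem integrable_gaussianKernel :
    Integrable (gaussianKernel : EuclideanSpace ℝ (Fin n) → ℝ) :=
  integrable_exp_neg_mul_sq_norm (by norm_num)

theorem integral_gaussianKernel_pos :
    0 < ∫ y : EuclideanSpace ℝ (Fin n), gaussianKernel y := by
  unfold gaussianKernel
  rw [GaussianFourier.integral_rexp_neg_mul_sq_norm (by norm_num)]
  positivity

theorem gaussianKernel_sq (y : EuclideanSpace ℝ (Fin n)) :
    gaussianKernel y ^ 2 = exp (-1 * ‖y‖ ^ 2) := by
  rw [gaussianKernel, ← exp_nat_mul]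
  congr 1
  push_cast
  ring

theorem integrable_gaussianKernel_sq :
    Integrable (fun y : EuclideanSpace ℝ (Fin n) => gaussianKernel y ^ 2) := by
  simp_rw [gaussianKernel_sq]
  exact integrable_exp_neg_mul_sq_norm one_pos

theorem integral_gaussianKernel_sq_pos :
    0 < ∫ y : EuclideanSpace ℝ (Fin n), gaussianKernel y ^ 2 := by
  simp_rw [gaussianKernel_sq]
  rw [GaussianFourier.integral_rexp_neg_mul_sq_norm one_pos]
  positivity

theorem integrable_norm_mul_gaussianKernel :
    Integrable (fun y : EuclideanSpace ℝ (Fin n) => ‖y‖ * gaussianKernel y) := by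
  refine ((integrable_exp_neg_mul_sq_norm (n := n) (b := 1 / 4) (by norm_num)).const_mul 2).mono'
    (continuous_norm.mul continuous_gaussianKernel).aestronglyMeasurable (.of_forall fun y => ?_)
  rw [Real.norm_of_nonneg (mul_nonneg (norm_nonneg _) (gaussianKernel_pos y).le)]
  have h1 : gaussianKernel y = exp (-(1 / 4) * ‖y‖ ^ 2) * exp (-(1 / 4 * ‖y‖ ^ 2)) := by
    rw [gaussianKernel, ← exp_add]
    congr 1
    ring
  have h2 : ‖y‖ * exp (-(1 / 4 * ‖y‖ ^ 2)) ≤ 2 := by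
    rw [exp_neg, ← div_eq_mul_inv, div_le_iff₀ (exp_pos _)]
    nlinarith [add_one_le_exp (1 / 4 * ‖y‖ ^ 2), sq_nonneg (‖y‖ - 1)]
  rw [h1]
  nlinarith [exp_pos (-(1 / 4) * ‖y‖ ^ 2)]

theorem hasFDerivAt_gaussianKernel (y : EuclideanSpace ℝ (Fin n)) :
    HasFDerivAt gaussianKernel (-gaussianKernel y • innerSL ℝ y) y := by
  have h := ((hasStrictFDerivAt_norm_sq y).hasFDerivAt.const_mul (-(1 / 2))).exp
  convert! h using 1
  ext z
  simp [gaussianKernel]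

theorem fderiv_gaussianKernel_single (y : EuclideanSpace ℝ (Fin n)) (i : Fin n) :
    fderiv ℝ gaussianKernel y (EuclideanSpace.single i 1) = -(y i * gaussianKernel y) := by
  rw [(hasFDerivAt_gaussianKernel y).fderiv]
  simp [EuclideanSpace.inner_single_right, mul_comm]

theorem integrable_mul_gaussianKernel {f : EuclideanSpace ℝ (Fin n) → ℝ} (hf : Continuous f)
    {c : ℝ} (hc : ∀ x, ‖f x‖ ≤ c) : Integrable (fun y => f y * gaussianKernel y) :=
  integrable_gaussianKernel.bdd_mul hf.aestronglyMeasurable (.of_forall hc)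

theorem integrable_mul_coord_mul_gaussianKernel {f : EuclideanSpace ℝ (Fin n) → ℝ}
    (hf : Continuous f) {c : ℝ} (hc : ∀ x, ‖f x‖ ≤ c) (i : Fin n) :
    Integrable (fun y => f y * (y i * gaussianKernel y)) := by
  refine Integrable.bdd_mul ?_ hf.aestronglyMeasurable (.of_forall hc)
  refine integrable_norm_mul_gaussianKernel.mono'
    ((by fun_prop : Continuous fun y : EuclideanSpace ℝ (Fin n) => y i).mul
      continuous_gaussianKernel).aestronglyMeasurable (.of_forall fun y => ?_)
  rw [norm_mul, Real.norm_of_nonneg (gaussianKernel_pos y).le]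
  exact mul_le_mul_of_nonneg_right (PiLp.norm_apply_le y i) (gaussianKernel_pos y).le

/-- Integration by parts against the Gaussian, in the `i`-th coordinate direction. -/
theorem integral_mul_coord_mul_gaussianKernel {f : EuclideanSpace ℝ (Fin n) → ℝ}
    (hf : ContDiff ℝ 1 f) {c c' : ℝ} (hc : ∀ x, ‖f x‖ ≤ c) (i : Fin n)
    (hc' : ∀ x, ‖fderiv ℝ f x (EuclideanSpace.single i 1)‖ ≤ c') :
    ∫ y, f y * (y i * gaussianKernel y)
      = ∫ y, fderiv ℝ f y (EuclideanSpace.single i 1) * gaussianKernel y := by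
  have h := integral_mul_fderiv_eq_neg_fderiv_mul_of_integrable (μ := volume) (f := f)
    (g := gaussianKernel) (v := EuclideanSpace.single i 1)
    (integrable_mul_gaussianKernel
      ((hf.continuous_fderiv one_ne_zero).clm_apply continuous_const) hc')
    (by simpa only [fderiv_gaussianKernel_single, mul_neg] using
      (integrable_mul_coord_mul_gaussianKernel hf.continuous hc i).fun_neg)
    (integrable_mul_gaussianKernel hf.continuous hc)
    (fun x _ => hf.differentiable one_ne_zero x)
    (fun x _ => (hasFDerivAt_gaussianKernel x).differentiableAt)
  simpa only [fderiv_gaussianKernel_single, mul_neg, integral_neg, neg_inj] using h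

end GaussianKernel

section GaussianMean

variable {n : ℕ} {v : EuclideanSpace ℝ (Fin n) → ℝ}

theorem hasDerivAt_integral_gaussianKernel (hv : ContDiff ℝ 2 v) (hs : HasCompactSupport v)
    (x : EuclideanSpace ℝ (Fin n)) (s : ℝ) :
    HasDerivAt (fun s : ℝ => ∫ y, v (x + s • y) * gaussianKernel y)
      (s * ∫ y, laplacian v (x + s • y) * gaussianKernel y) s := by
  have hdv : Continuous (fderiv ℝ v) := hv.continuous_fderiv two_ne_zero
  obtain ⟨c₀, hc₀⟩ := hs.exists_bound_of_continuous hv.continuous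
  obtain ⟨c₁, hc₁⟩ := (hs.fderiv (𝕜 := ℝ)).exists_bound_of_continuous hdv
  let e : Fin n → EuclideanSpace ℝ (Fin n) := fun i => EuclideanSpace.single i 1
  have hD : ∀ i, ContDiff ℝ 1 (fun y => fderiv ℝ v y (e i)) := fun i =>
    (hv.fderiv_right (by norm_num)).clm_apply contDiff_const
  have hDs : ∀ i, HasCompactSupport (fun y => fderiv ℝ v y (e i)) := fun i =>
    hs.fderiv_apply (𝕜 := ℝ) (e i)
  have hDD : ∀ i, Continuous fun y => fderiv ℝ (fun z => fderiv ℝ v z (e i)) y (e i) := fun i =>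
    ((hD i).continuous_fderiv one_ne_zero).clm_apply continuous_const
  choose c hc using fun i => (hDs i).exists_bound_of_continuous (hD i).continuous
  choose d hd using fun i =>
    ((hDs i).fderiv_apply (𝕜 := ℝ) (e i)).exists_bound_of_continuous (hDD i)
  have hline : ∀ t : ℝ, Continuous fun y : EuclideanSpace ℝ (Fin n) => x + t • y := fun t => by
    fun_prop
  have key := (hasDerivAt_integral_of_dominated_loc_of_deriv_le (μ := volume)
    (F := fun (s : ℝ) y => v (x + s • y) * gaussianKernel y)
    (F' := fun (s : ℝ) y => fderiv ℝ v (x + s • y) y * gaussianKernel y) (x₀ := s)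
    (bound := fun y => c₁ * (‖y‖ * gaussianKernel y)) Filter.univ_mem
    (.of_forall fun t =>
      ((hv.continuous.comp (hline t)).mul continuous_gaussianKernel).aestronglyMeasurable)
    (integrable_mul_gaussianKernel (hv.continuous.comp (hline s)) fun y => hc₀ _)
    (((hdv.comp (hline s)).clm_apply continuous_id).mul
      continuous_gaussianKernel).aestronglyMeasurable
    (.of_forall fun y t _ => by
      rw [norm_mul, Real.norm_of_nonneg (gaussianKernel_pos y).le, ← mul_assoc]
      exact mul_le_mul_of_nonneg_right ((fderiv ℝ v _).le_of_opNorm_le (hc₁ _) y)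
        (gaussianKernel_pos y).le)
    (integrable_norm_mul_gaussianKernel.const_mul c₁)
    (.of_forall fun y t _ => by
      have h1 : HasDerivAt (fun t : ℝ => x + t • y) y t := by
        simpa using ((hasDerivAt_id t).smul_const y).const_add x
      exact ((hv.differentiable two_ne_zero _).hasFDerivAt.comp_hasDerivAt t h1).mul_const _)).2
  refine key.congr_deriv ?_
  have hcoord : ∀ y, fderiv ℝ v (x + s • y) y * gaussianKernel y
      = ∑ i, fderiv ℝ v (x + s • y) (e i) * (y i * gaussianKernel y) := fun y => by
    have hy : y = ∑ i, y i • e i := by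
      simpa [e] using ((EuclideanSpace.basisFun (Fin n) ℝ).sum_repr y).symm
    conv_lhs => rw [show fderiv ℝ v (x + s • y) y = fderiv ℝ v (x + s • y) (∑ i, y i • e i) by
      rw [← hy]]
    rw [map_sum, Finset.sum_mul]
    refine Finset.sum_congr rfl fun i _ => ?_
    rw [map_smul, smul_eq_mul]
    ring
  have hfd : ∀ i y, fderiv ℝ (fun y => fderiv ℝ v (x + s • y) (e i)) y (e i)
      = s * fderiv ℝ (fun z => fderiv ℝ v z (e i)) (x + s • y) (e i) := fun i y => by
    have h1 : HasFDerivAt (fun y : EuclideanSpace ℝ (Fin n) => x + s • y)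
        (s • ContinuousLinearMap.id ℝ _) y := ((hasFDerivAt_id y).const_smul s).const_add x
    have h2 := ((hD i).differentiable one_ne_zero (x + s • y)).hasFDerivAt.comp y h1
    rw [show (fun y => fderiv ℝ v (x + s • y) (e i))
      = (fun z => fderiv ℝ v z (e i)) ∘ (fun y => x + s • y) from rfl, h2.fderiv]
    simp
  have hDc : ∀ i, ContDiff ℝ 1 (fun y => fderiv ℝ v (x + s • y) (e i)) := fun i =>
    (hD i).comp (by fun_prop)
  rw [integral_congr_ae (.of_forall hcoord)]
  rw [integral_finsetSum _ fun i _ => integrable_mul_coord_mul_gaussianKernel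
    (hDc i).continuous (fun y => hc i _) i]
  have hlap : ∫ y, laplacian v (x + s • y) * gaussianKernel y = ∑ i, ∫ y,
      fderiv ℝ (fun z => fderiv ℝ v z (e i)) (x + s • y) (e i) * gaussianKernel y := by
    simp_rw [laplacian, Finset.sum_mul]
    exact integral_finsetSum _ fun i _ => integrable_mul_gaussianKernel
      ((hDD i).comp (hline s)) (fun y => hd i _)
  rw [hlap, Finset.mul_sum]
  refine Finset.sum_congr rfl fun i _ => ?_
  rw [integral_mul_coord_mul_gaussianKernel (hDc i) (c' := |s| * d i) (fun y => hc i _) i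
    fun y => ?_]
  · rw [← integral_const_mul]
    refine integral_congr_ae (.of_forall fun y => ?_)
    change fderiv ℝ (fun y => fderiv ℝ v (x + s • y) (e i)) y (e i) * _ = _
    rw [hfd, mul_assoc]
  · change ‖fderiv ℝ (fun y => fderiv ℝ v (x + s • y) (e i)) y (e i)‖ ≤ _
    rw [hfd, norm_mul, Real.norm_eq_abs s]
    exact mul_le_mul_of_nonneg_left (hd i _) (abs_nonneg s)

/-- A Gaussian sub-mean value inequality for functions whose Laplacian is bounded below. -/
theorem mul_integral_gaussianKernel_le (hv : ContDiff ℝ 2 v) (hs : HasCompactSupport v) {L : ℝ}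
    (hL : ∀ x, -L ≤ laplacian v x) (x : EuclideanSpace ℝ (Fin n)) {s : ℝ} (hs0 : 0 ≤ s) :
    v x * ∫ y : EuclideanSpace ℝ (Fin n), gaussianKernel y
      ≤ (∫ y, v (x + s • y) * gaussianKernel y)
        + L * (∫ y : EuclideanSpace ℝ (Fin n), gaussianKernel y) * s ^ 2 / 2 := by
  set A := ∫ y : EuclideanSpace ℝ (Fin n), gaussianKernel y with hA
  have hder : ∀ t : ℝ, HasDerivAt
      (fun t : ℝ => (∫ y, v (x + t • y) * gaussianKernel y) + L * A * t ^ 2 / 2)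
      (t * (∫ y, laplacian v (x + t • y) * gaussianKernel y) + L * A * t) t := fun t => by
    refine (hasDerivAt_integral_gaussianKernel hv hs x t).add ?_
    have := ((hasDerivAt_pow 2 t).const_mul (L * A)).div_const 2
    convert! this using 1
    simp
    ring
  have hD : ∀ i : Fin n, ContDiff ℝ 1 (fun y => fderiv ℝ v y (EuclideanSpace.single i 1)) :=
    fun i => (hv.fderiv_right (by norm_num)).clm_apply contDiff_const
  have hDD : ∀ i : Fin n, Continuous fun y => fderiv ℝ
      (fun z => fderiv ℝ v z (EuclideanSpace.single i 1)) y (EuclideanSpace.single i 1) :=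
    fun i => ((hD i).continuous_fderiv one_ne_zero).clm_apply continuous_const
  have hlap : Continuous (laplacian v) := continuous_finsetSum _ fun i _ => hDD i
  choose d hd using fun i : Fin n =>
    ((hs.fderiv_apply (𝕜 := ℝ) (EuclideanSpace.single i 1)).fderiv_apply (𝕜 := ℝ)
      (EuclideanSpace.single i 1)).exists_bound_of_continuous (hDD i)
  have hlapb : ∀ x, ‖laplacian v x‖ ≤ ∑ i, d i := fun x =>
    norm_sum_le_of_le _ fun i _ => hd i x
  have hmono : MonotoneOn
      (fun t : ℝ => (∫ y, v (x + t • y) * gaussianKernel y) + L * A * t ^ 2 / 2) (Set.Ici 0) := by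
    refine monotoneOn_of_deriv_nonneg (convex_Ici 0)
      (fun t _ => (hder t).continuousAt.continuousWithinAt)
      (fun t _ => (hder t).differentiableAt.differentiableWithinAt) fun t ht => ?_
    rw [interior_Ici] at ht
    rw [(hder t).deriv]
    have h1 : -L * A ≤ ∫ y, laplacian v (x + t • y) * gaussianKernel y := by
      rw [hA, ← integral_const_mul]
      refine integral_mono (integrable_gaussianKernel.const_mul _)
        (integrable_mul_gaussianKernel (hlap.comp (by fun_prop)) fun y => hlapb _) fun y => ?_
      exact mul_le_mul_of_nonneg_right (hL _) (gaussianKernel_pos y).le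
    nlinarith [Set.mem_Ioi.1 ht]
  have h := hmono Set.self_mem_Ici (Set.mem_Ici.2 hs0) hs0
  simpa [integral_const_mul, ← hA] using h

end GaussianMean

section PositivePart

theorem hasDerivAt_max_zero_pow (k : ℕ) (t : ℝ) :
    HasDerivAt (fun t : ℝ => max t 0 ^ (k + 2)) ((k + 2) * max t 0 ^ (k + 1)) t := by
  refine hasDerivAt_of_hasDerivAt_of_ne' (x := 0)
    (f := fun t : ℝ => max t 0 ^ (k + 2)) (g := fun t : ℝ => (k + 2) * max t 0 ^ (k + 1))
    (fun y hy => ?_) (by fun_prop) (by fun_prop) t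
  rcases lt_or_gt_of_ne hy with hy | hy
  · have h : (fun t : ℝ => max t 0 ^ (k + 2)) =ᶠ[nhds y] fun _ => 0 := by
      filter_upwards [Iio_mem_nhds hy] with t ht
      simp [max_eq_right (Set.mem_Iio.1 ht).le]
    simpa [max_eq_right hy.le] using (hasDerivAt_const y (0 : ℝ)).congr_of_eventuallyEq h
  · have h : (fun t : ℝ => max t 0 ^ (k + 2)) =ᶠ[nhds y] fun t => t ^ (k + 2) := by
      filter_upwards [Ioi_mem_nhds hy] with t ht
      simp [max_eq_left (Set.mem_Ioi.1 ht).le]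
    simpa [max_eq_left hy.le] using (hasDerivAt_pow (k + 2) y).congr_of_eventuallyEq h

theorem hasDerivAt_max_zero_cube (t : ℝ) :
    HasDerivAt (fun t : ℝ => max t 0 ^ 3) (3 * max t 0 ^ 2) t := by
  convert! hasDerivAt_max_zero_pow 1 t using 2
  norm_num

theorem hasDerivAt_max_zero_sq (t : ℝ) :
    HasDerivAt (fun t : ℝ => max t 0 ^ 2) (2 * max t 0) t := by
  simpa using hasDerivAt_max_zero_pow 0 t

theorem contDiff_max_zero_cube : ContDiff ℝ 2 (fun t : ℝ => max t 0 ^ 3) := by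
  have h2 : ContDiff ℝ 1 (fun t : ℝ => max t 0 ^ 2) := by
    rw [contDiff_one_iff_deriv]
    refine ⟨fun t => (hasDerivAt_max_zero_sq t).differentiableAt, ?_⟩
    rw [show deriv (fun t : ℝ => max t 0 ^ 2) = fun t => 2 * max t 0 from
      funext fun t => (hasDerivAt_max_zero_sq t).deriv]
    fun_prop
  rw [show (2 : WithTop ℕ∞) = 1 + 1 by norm_num, contDiff_succ_iff_deriv]
  refine ⟨fun t => (hasDerivAt_max_zero_cube t).differentiableAt, by simp, ?_⟩
  rw [show deriv (fun t : ℝ => max t 0 ^ 3) = fun t => 3 * max t 0 ^ 2 from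
    funext fun t => (hasDerivAt_max_zero_cube t).deriv]
  exact contDiff_const.mul h2

end PositivePart

section Laplacian

variable {n : ℕ} {f g φ : EuclideanSpace ℝ (Fin n) → ℝ} {x : EuclideanSpace ℝ (Fin n)}

theorem laplacian_congr (h : f =ᶠ[nhds x] g) : laplacian f x = laplacian g x := by
  refine Finset.sum_congr rfl fun i _ => ?_
  have h' : (fun y => fderiv ℝ f y (EuclideanSpace.single i 1)) =ᶠ[nhds x]
      fun y => fderiv ℝ g y (EuclideanSpace.single i 1) :=
    (h.fderiv (𝕜 := ℝ)).mono fun y hy => by simp only [hy]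
  rw [h'.fderiv_eq]

theorem laplacian_zero : laplacian (fun _ : EuclideanSpace ℝ (Fin n) => (0 : ℝ)) x = 0 := by
  simp [laplacian]

theorem le_laplacian_max_sub_cube {U : Set (EuclideanSpace ℝ (Fin n))} (hU : IsOpen U)
    (hφ : ContDiffOn ℝ 2 φ U) (ε : ℝ) (hx : x ∈ U) :
    3 * max (φ x - ε) 0 ^ 2 * laplacian φ x
      ≤ laplacian (fun y => max (φ y - ε) 0 ^ 3) x := by
  have hd : ∀ y ∈ U, HasFDerivAt φ (fderiv ℝ φ y) y := fun y hy =>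
    ((hφ.contDiffAt (hU.mem_nhds hy)).differentiableAt two_ne_zero).hasFDerivAt
  have hφx : ContDiffAt ℝ 2 φ x := hφ.contDiffAt (hU.mem_nhds hx)
  rw [laplacian, laplacian, Finset.mul_sum]
  refine Finset.sum_le_sum fun i _ => ?_
  set e : EuclideanSpace ℝ (Fin n) := EuclideanSpace.single i 1
  have h1 : (fun y => fderiv ℝ (fun y => max (φ y - ε) 0 ^ 3) y e) =ᶠ[nhds x]
      fun y => 3 * max (φ y - ε) 0 ^ 2 * fderiv ℝ φ y e := by
    filter_upwards [hU.mem_nhds hx] with y hy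
    have hcomp := (hasDerivAt_max_zero_cube (φ y - ε)).comp_hasFDerivAt y
      ((hd y hy).sub_const ε)
    have hy' : HasFDerivAt (fun y => max (φ y - ε) 0 ^ 3)
        ((3 * max (φ y - ε) 0 ^ 2) • fderiv ℝ φ y) y := hcomp
    rw [hy'.fderiv]
    rfl
  have h2 : HasFDerivAt (fun y => fderiv ℝ φ y e) (fderiv ℝ (fun y => fderiv ℝ φ y e) x) x :=
    (((hφx.fderiv_right (m := 1) (by norm_num)).clm_apply contDiffAt_const).differentiableAt
      one_ne_zero).hasFDerivAt
  have h3 := (((hasDerivAt_max_zero_sq (φ x - ε)).comp_hasFDerivAt x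
    ((hd x hx).sub_const ε)).const_mul 3).mul h2
  have h4 : HasFDerivAt (fun y => 3 * max (φ y - ε) 0 ^ 2 * fderiv ℝ φ y e) _ x := h3
  rw [h1.fderiv_eq, h4.fderiv]
  simp only [add_apply, smul_apply, smul_eq_mul,
    Function.comp_apply]
  have : 0 ≤ max (φ x - ε) 0 * fderiv ℝ φ x e ^ 2 :=
    mul_nonneg (le_max_right _ _) (sq_nonneg _)
  nlinarith

end Laplacian

theorem dirichletEigenvalue_nonneg (n : ℕ) (U : Set (EuclideanSpace ℝ (Fin n))) :
    0 ≤ dirichletEigenvalue n U := by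
  refine Real.sInf_nonneg ?_
  rintro _ ⟨f, -, -, -, -, rfl⟩
  exact div_nonneg (integral_nonneg fun _ => sq_nonneg _) (integral_nonneg fun _ => sq_nonneg _)

namespace IsPrincipalDirichletEigenfunction

variable {n : ℕ} {U : Set (EuclideanSpace ℝ (Fin n))} {φ : EuclideanSpace ℝ (Fin n) → ℝ}

theorem integrableOn_sq (hφ : IsPrincipalDirichletEigenfunction U φ) :
    IntegrableOn (fun x => φ x ^ 2) U :=
  Integrable.of_integral_ne_zero (by rw [hφ.normalized]; exact one_ne_zero)

theorem exists_isMax (hφ : IsPrincipalDirichletEigenfunction U φ) (hne : U.Nonempty)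
    (hU : IsOpen U) (hb : Bornology.IsBounded U) : ∃ x ∈ U, ∀ y ∈ U, φ y ≤ φ x := by
  obtain ⟨x, hx, hmax⟩ := hb.isCompact_closure.exists_isMaxOn hne.closure hφ.continuousOn
  obtain ⟨z, hz⟩ := hne
  refine ⟨x, ?_, fun y hy => hmax (subset_closure hy)⟩
  by_contra hxU
  have h0 : φ x = 0 := hφ.vanishes x (by rw [hU.frontier_eq]; exact ⟨hx, hxU⟩)
  have h1 : φ z ≤ φ x := hmax (subset_closure hz)
  linarith [hφ.pos z hz]

theorem one_div_volume_le (hφ : IsPrincipalDirichletEigenfunction U φ) (hU : IsOpen U)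
    (hb : Bornology.IsBounded U) {x : EuclideanSpace ℝ (Fin n)} (hx : x ∈ U)
    (hmax : ∀ y ∈ U, φ y ≤ φ x) : 1 / (volume U).toReal ≤ φ x ^ 2 := by
  have hvol : 0 < (volume U).toReal :=
    ENNReal.toReal_pos (hU.measure_pos volume ⟨x, hx⟩).ne' hb.measure_lt_top.ne
  rw [div_le_iff₀ hvol]
  calc (1 : ℝ) = ∫ y in U, φ y ^ 2 := hφ.normalized.symm
    _ ≤ ∫ _ in U, φ x ^ 2 :=
      setIntegral_mono_on hφ.integrableOn_sq (integrableOn_const hb.measure_lt_top.ne)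
        hU.measurableSet fun y hy => pow_le_pow_left₀ (hφ.pos y hy).le (hmax y hy) 2
    _ = φ x ^ 2 * (volume U).toReal := by
      rw [setIntegral_const, smul_eq_mul, mul_comm, measureReal_def]

theorem truncation_mul_le (hφ : IsPrincipalDirichletEigenfunction U φ) (hU : IsOpen U)
    (hb : Bornology.IsBounded U) {x : EuclideanSpace ℝ (Fin n)} (hx : x ∈ U)
    (hmax : ∀ y ∈ U, φ y ≤ φ x) {ε : ℝ} (hε : 0 < ε) {s a : ℝ} (hs : 0 < s) (ha : 0 < a) :
    (φ x - ε) ^ 3 * (∫ y : EuclideanSpace ℝ (Fin n), gaussianKernel y) ≤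
      a * (s ^ n)⁻¹ * φ x ^ 4 / 2
        + (∫ y : EuclideanSpace ℝ (Fin n), gaussianKernel y ^ 2) / (2 * a)
        + 3 * dirichletEigenvalue n U * φ x ^ 3
          * (∫ y : EuclideanSpace ℝ (Fin n), gaussianKernel y) * s ^ 2 / 2 := by
  have hlam := dirichletEigenvalue_nonneg n U
  have hM : 0 < φ x := hφ.pos x hx
  let v : EuclideanSpace ℝ (Fin n) → ℝ := U.indicator fun y => max (φ y - ε) 0 ^ 3
  have hvU : ∀ y ∈ U, v y = max (φ y - ε) 0 ^ 3 := fun y hy => Set.indicator_of_mem hy _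
  have hvU' : ∀ y ∉ U, v y = 0 := fun y hy => Set.indicator_of_notMem hy _
  have hmaxU : ∀ y ∈ U, max (φ y - ε) 0 ≤ φ y := fun y hy =>
    max_le (by linarith) (hφ.pos y hy).le
  let K : Set (EuclideanSpace ℝ (Fin n)) := closure U ∩ φ ⁻¹' Set.Ici ε
  have hKcl : IsClosed K := hφ.continuousOn.preimage_isClosed_of_isClosed isClosed_closure
    isClosed_Ici
  have hK : IsCompact K := hb.isCompact_closure.of_isClosed_subset hKcl Set.inter_subset_left
  have hKU : K ⊆ U := fun y hy => by
    by_contra hyU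
    have h0 := hφ.vanishes y (by rw [hU.frontier_eq]; exact ⟨hy.1, hyU⟩)
    have h1 : ε ≤ φ y := hy.2
    linarith
  have hvK : ∀ y ∉ K, v y = 0 := fun y hy => by
    by_cases hyU : y ∈ U
    · have h1 : φ y < ε := not_le.1 fun h => hy ⟨subset_closure hyU, h⟩
      rw [hvU y hyU, max_eq_right (by linarith)]
      norm_num
    · exact hvU' y hyU
  have hvs : HasCompactSupport v := HasCompactSupport.intro hK hvK
  have hφ2 : ContDiffOn ℝ 2 φ U := hφ.smooth.of_le (WithTop.coe_le_coe.2 le_top)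
  have hin : ∀ y ∈ U, v =ᶠ[nhds y] fun y => max (φ y - ε) 0 ^ 3 := fun y hy =>
    Filter.eventuallyEq_of_mem (hU.mem_nhds hy) hvU
  have hout : ∀ y ∉ U, v =ᶠ[nhds y] fun _ => 0 := fun y hy =>
    Filter.eventuallyEq_of_mem (hKcl.isOpen_compl.mem_nhds fun h => hy (hKU h)) hvK
  have hv : ContDiff ℝ 2 v := contDiff_iff_contDiffAt.2 fun y => by
    by_cases hy : y ∈ U
    · exact (contDiff_max_zero_cube.contDiffAt.comp y
        ((hφ2.contDiffAt (hU.mem_nhds hy)).sub contDiffAt_const)).congr_of_eventuallyEq (hin y hy)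
    · exact contDiffAt_const.congr_of_eventuallyEq (hout y hy)
  have hL : ∀ y, -(3 * dirichletEigenvalue n U * φ x ^ 3) ≤ laplacian v y := fun y => by
    by_cases hy : y ∈ U
    · rw [laplacian_congr (hin y hy)]
      refine le_trans ?_ (le_laplacian_max_sub_cube hU hφ2 ε hy)
      rw [hφ.eigenEq y hy]
      have h1 : max (φ y - ε) 0 ^ 2 * φ y ≤ φ x ^ 2 * φ x :=
        mul_le_mul (pow_le_pow_left₀ (le_max_right _ _) ((hmaxU y hy).trans (hmax y hy)) 2)
          (hmax y hy) (hφ.pos y hy).le (sq_nonneg _)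
      nlinarith [mul_le_mul_of_nonneg_left h1 hlam]
    · rw [laplacian_congr (hout y hy), laplacian_zero, neg_nonpos]
      positivity
  have hmean := mul_integral_gaussianKernel_le hv hvs hL x hs.le
  have hvsq : Integrable fun y => v y ^ 2 :=
    (hv.continuous.pow 2).integrable_of_hasCompactSupport
      (HasCompactSupport.intro hK fun y hy => by simp [hvK y hy])
  have hvsq' : Integrable fun y => v (x + s • y) ^ 2 :=
    (hvsq.comp_add_left x).comp_smul hs.ne'
  have hint : ∫ y, v y ^ 2 ≤ φ x ^ 4 := by
    calc ∫ y, v y ^ 2 = ∫ y in U, v y ^ 2 :=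
          (setIntegral_eq_integral_of_forall_compl_eq_zero fun y hy => by
            rw [hvU' y hy]; norm_num).symm
      _ ≤ ∫ y in U, φ x ^ 4 * φ y ^ 2 := by
          refine setIntegral_mono_on hvsq.integrableOn (hφ.integrableOn_sq.const_mul _)
            hU.measurableSet fun y hy => ?_
          have h0 : 0 ≤ max (φ y - ε) 0 := le_max_right _ _
          have h1 : max (φ y - ε) 0 ≤ φ x := (hmaxU y hy).trans (hmax y hy)
          calc v y ^ 2 = max (φ y - ε) 0 ^ 4 * max (φ y - ε) 0 ^ 2 := by rw [hvU y hy]; ring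
            _ ≤ φ x ^ 4 * φ y ^ 2 := by
              gcongr
              exact hmaxU y hy
      _ = φ x ^ 4 := by rw [integral_const_mul, hφ.normalized, mul_one]
  have hscale : ∫ y, v (x + s • y) ^ 2 = (s ^ n)⁻¹ * ∫ y, v y ^ 2 := by
    rw [Measure.integral_comp_smul volume (fun y => v (x + y) ^ 2) s,
      integral_add_left_eq_self (fun y => v y ^ 2) x, finrank_euclideanSpace_fin, smul_eq_mul,
      abs_of_pos (by positivity)]
  obtain ⟨c, hc⟩ := hvs.exists_bound_of_continuous hv.continuous
  have hCS : ∫ y, v (x + s • y) * gaussianKernel y ≤ a * (s ^ n)⁻¹ * φ x ^ 4 / 2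
        + (∫ y : EuclideanSpace ℝ (Fin n), gaussianKernel y ^ 2) / (2 * a) := by
    calc ∫ y, v (x + s • y) * gaussianKernel y
        ≤ ∫ y, (a / 2 * v (x + s • y) ^ 2 + 1 / (2 * a) * gaussianKernel y ^ 2) := by
          refine integral_mono (integrable_mul_gaussianKernel
            (hv.continuous.comp (by fun_prop)) fun y => hc _)
            ((hvsq'.const_mul _).add (integrable_gaussianKernel_sq.const_mul _)) fun y => ?_
          have h : 0 ≤ (a * v (x + s • y) - gaussianKernel y) ^ 2 / (2 * a) := by positivity
          have h' : (a * v (x + s • y) - gaussianKernel y) ^ 2 / (2 * a)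
              = a / 2 * v (x + s • y) ^ 2 + 1 / (2 * a) * gaussianKernel y ^ 2
                - v (x + s • y) * gaussianKernel y := by
            field_simp
            ring
          linarith
      _ = a / 2 * ((s ^ n)⁻¹ * ∫ y, v y ^ 2)
          + 1 / (2 * a) * ∫ y : EuclideanSpace ℝ (Fin n), gaussianKernel y ^ 2 := by
          rw [integral_add (hvsq'.const_mul _) (integrable_gaussianKernel_sq.const_mul _),
            integral_const_mul, integral_const_mul, hscale]
      _ ≤ a / 2 * ((s ^ n)⁻¹ * φ x ^ 4)
          + 1 / (2 * a) * ∫ y : EuclideanSpace ℝ (Fin n), gaussianKernel y ^ 2 := by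
          gcongr
      _ = _ := by ring
  have hvx : (φ x - ε) ^ 3 ≤ v x := by
    rw [hvU x hx]
    exact (Odd.strictMono_pow (by decide : Odd 3)).monotone (le_max_left _ _)
  have := mul_le_mul_of_nonneg_right hvx (integral_gaussianKernel_pos (n := n)).le
  linarith

/-- The quantitative local maximum principle at scale `s ≲ λ ^ (-1 / 2)`. -/
theorem sq_mul_le (hφ : IsPrincipalDirichletEigenfunction U φ) (hU : IsOpen U)
    (hb : Bornology.IsBounded U) {x : EuclideanSpace ℝ (Fin n)} (hx : x ∈ U)
    (hmax : ∀ y ∈ U, φ y ≤ φ x) {s : ℝ} (hs : 0 < s)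
    (hlam : 3 * dirichletEigenvalue n U * s ^ 2 ≤ 1) :
    φ x ^ 2 * ((∫ y : EuclideanSpace ℝ (Fin n), gaussianKernel y) ^ 2 * s ^ n)
      ≤ 4 * ∫ y : EuclideanSpace ℝ (Fin n), gaussianKernel y ^ 2 := by
  have hM : 0 < φ x := hφ.pos x hx
  have hA := integral_gaussianKernel_pos (n := n)
  have hsn : 0 < s ^ n := pow_pos hs n
  have hlim := fun (ε : ℝ) (hε : 0 < ε) (a : ℝ) (ha : 0 < a) =>
    hφ.truncation_mul_le hU hb hx hmax hε hs ha
  set A := ∫ y : EuclideanSpace ℝ (Fin n), gaussianKernel y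
  set B := ∫ y : EuclideanSpace ℝ (Fin n), gaussianKernel y ^ 2
  set a := A * s ^ n / (2 * φ x) with ha
  have hapos : 0 < a := by positivity
  have ht : Filter.Tendsto (fun ε => (φ x - ε) ^ 3 * A) (nhdsWithin 0 (Set.Ioi 0))
      (nhds ((φ x - 0) ^ 3 * A)) :=
    (Continuous.tendsto (by fun_prop) 0).mono_left nhdsWithin_le_nhds
  have h := le_of_tendsto ht (Filter.eventually_of_mem self_mem_nhdsWithin
    fun ε hε => hlim ε hε a hapos)
  rw [sub_zero] at h
  have h1 : a * (s ^ n)⁻¹ * φ x ^ 4 / 2 = φ x ^ 3 * A / 4 := by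
    rw [ha]
    field_simp
    norm_num
  have h2 : B / (2 * a) = B * φ x / (A * s ^ n) := by
    rw [ha]
    field_simp
  have h3 : 3 * dirichletEigenvalue n U * φ x ^ 3 * A * s ^ 2 / 2 ≤ φ x ^ 3 * A / 2 := by
    have : 0 ≤ φ x ^ 3 * A := by positivity
    nlinarith
  have h4 : φ x ^ 3 * A / 4 ≤ B * φ x / (A * s ^ n) := by linarith
  rw [le_div_iff₀ (by positivity)] at h4
  refine le_of_mul_le_mul_left ?_ hM
  linarith

end IsPrincipalDirichletEigenfunction

theorem stmt_5 (n : ℕ) (hn : 1 ≤ n) :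
    ∃ C > (0 : ℝ), ∀ U : Set (EuclideanSpace ℝ (Fin n)), U.Nonempty → IsOpen U →
      Bornology.IsBounded U →
      ∀ φ : EuclideanSpace ℝ (Fin n) → ℝ, IsPrincipalDirichletEigenfunction U φ →
        1 / (volume U).toReal ≤ (sSup (φ '' U)) ^ 2 ∧
        (sSup (φ '' U)) ^ 2 ≤ C * dirichletEigenvalue n U ^ ((n : ℝ) / 2) := by
  have hA := integral_gaussianKernel_pos (n := n)
  have hB := integral_gaussianKernel_sq_pos (n := n)
  set A := ∫ y : EuclideanSpace ℝ (Fin n), gaussianKernel y with hAdef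
  set B := ∫ y : EuclideanSpace ℝ (Fin n), gaussianKernel y ^ 2 with hBdef
  refine ⟨4 * B / A ^ 2 * 3 ^ ((n : ℝ) / 2), by positivity, fun U hne hU hb φ hφ => ?_⟩
  obtain ⟨x, hx, hmax⟩ := hφ.exists_isMax hne hU hb
  have hsup : sSup (φ '' U) = φ x :=
    IsGreatest.csSup_eq ⟨Set.mem_image_of_mem φ hx, Set.forall_mem_image.2 hmax⟩
  rw [hsup]
  refine ⟨hφ.one_div_volume_le hU hb hx hmax, ?_⟩
  have hM : 0 < φ x := hφ.pos x hx
  have key := fun (s : ℝ) (hs : 0 < s) => hφ.sq_mul_le hU hb hx hmax hs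
  rw [← hAdef, ← hBdef] at key
  rcases (dirichletEigenvalue_nonneg n U).eq_or_lt with h0 | hlam
  · exfalso
    set s := 1 + 4 * B / (φ x ^ 2 * A ^ 2) with hs
    have hs1 : 1 ≤ s := le_add_of_nonneg_right (by positivity)
    have h1 := key s (by positivity) (by rw [← h0]; norm_num)
    have h2 : φ x ^ 2 * (A ^ 2 * s) ≤ φ x ^ 2 * (A ^ 2 * s ^ n) := by
      gcongr
      exact le_self_pow₀ hs1 (by omega)
    have h3 : φ x ^ 2 * (A ^ 2 * s) = φ x ^ 2 * A ^ 2 + 4 * B := by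
      rw [hs]
      field_simp
    have h4 : 0 < φ x ^ 2 * A ^ 2 := by positivity
    linarith
  · set l := dirichletEigenvalue n U
    have hl : 0 < 3 * l := by positivity
    have h1 := key (√(3 * l))⁻¹ (by positivity) (by
      rw [inv_pow, sq_sqrt hl.le, mul_inv_cancel₀ hl.ne'])
    have h2 : √(3 * l) ^ n = 3 ^ ((n : ℝ) / 2) * l ^ ((n : ℝ) / 2) := by
      rw [sqrt_eq_rpow, ← rpow_natCast, ← rpow_mul hl.le, mul_rpow (by norm_num) hlam.le]
      ring_nf
    have h3 : 0 < √(3 * l) ^ n := by positivity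
    rw [mul_assoc, ← h2]
    rw [inv_pow, ← mul_assoc, ← div_eq_mul_inv, div_le_iff₀ h3,
      ← le_div_iff₀ (by positivity)] at h1
    refine h1.trans (le_of_eq ?_)
    ring
end
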